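/- (Bollobás–Radcliffe) A nonempty set system 𝓕 ⊆ 2^[n] is s-extremal if and only if for every B ⊆ [n] with 𝓕(B) ≠ ∅, the inclusion graph G_{𝓕(B)} is connected, where 𝓕(B) = { I ⊆ [n] ∖ B : I ∪ H ∈ 𝓕 for every H ⊆ B }. -/

import Mathlib

open Finset

/-- The family of subsets of `[n]` (identified with `Fin n`) shattered by the
set system `F ⊆ 2^[n]`. -/
def Sh (n : ℕ) (F : Finset (Finset (Fin n))) : Finset (Finset (Fin n)) :=
  Finset.univ.filter (fun S => ∀ H ∈ S.powerset, ∃ A ∈ F, A ∩ S = H)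

/-- A set system is shattering-extremal (s-extremal) if it shatters exactly
`|F|` sets. -/
def SExtremal (n : ℕ) (F : Finset (Finset (Fin n))) : Prop :=
  (Sh n F).card = F.card

/-- The inclusion graph of a set system: vertices are the members of `F`,
two sets adjacent iff their symmetric difference is a single element. -/
def inclGraph (n : ℕ) (F : Finset (Finset (Fin n))) : SimpleGraph {A // A ∈ F} where
  Adj A B := (symmDiff A.1 B.1).card = 1
  symm := by constructor; intro A B h; rwa [symmDiff_comm]
  loopless := by constructor; intro A h; simp [symmDiff_self] at h

/-- The system `F(B) = { I ⊆ [n] \ B : I ∪ H ∈ F for all H ⊆ B }`. -/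
def sysB (n : ℕ) (F : Finset (Finset (Fin n))) (B : Finset (Fin n)) :
    Finset (Finset (Fin n)) :=
  Bᶜ.powerset.filter (fun I => ∀ H ∈ B.powerset, I ∪ H ∈ F)

section

variable {n : ℕ} {F : Finset (Finset (Fin n))}

theorem Sh_eq_shatterer : Sh n F = F.shatterer := by
  ext S
  simp [Sh, Shatters, inter_comm]

theorem mem_sysB {B I : Finset (Fin n)} :
    I ∈ sysB n F B ↔ Disjoint I B ∧ ∀ H ⊆ B, I ∪ H ∈ F := by
  simp [sysB, subset_compl_iff_disjoint_right]

theorem mem_sysB_singleton {x : Fin n} {I : Finset (Fin n)} :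
    I ∈ sysB n F {x} ↔ x ∉ I ∧ I ∈ F ∧ insert x I ∈ F := by
  simp [mem_sysB, subset_singleton_iff, union_singleton]

theorem sysB_empty : sysB n F ∅ = F := by
  ext I
  simp [mem_sysB, subset_empty]

theorem sysB_insert {B : Finset (Fin n)} {x : Fin n} (hx : x ∉ B) :
    sysB n F (insert x B) = sysB n (sysB n F B) {x} := by
  ext I
  rw [mem_sysB_singleton]
  simp only [mem_sysB, disjoint_insert_right, disjoint_insert_left]
  refine ⟨fun ⟨⟨h1, h2⟩, h3⟩ => ⟨h1, ⟨h2, fun H hH => h3 H (hH.trans (subset_insert _ _))⟩,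
    ⟨hx, h2⟩, fun H hH => ?_⟩, fun ⟨h1, ⟨h2, h3⟩, _, h4⟩ => ⟨⟨h1, h2⟩, fun H hH => ?_⟩⟩
  · simpa using h3 (insert x H) (insert_subset_insert x hH)
  · by_cases hxH : x ∈ H
    · have := h4 (H.erase x) (by rwa [← subset_insert_iff])
      rwa [insert_union, ← union_insert, insert_erase hxH] at this
    · exact h3 H ((subset_insert_iff_of_notMem hxH).1 hH)

theorem sysB_insert' {B : Finset (Fin n)} {x : Fin n} (hx : x ∉ B) :
    sysB n F (insert x B) = sysB n (sysB n F {x}) B := by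
  induction B using Finset.induction_on with
  | empty => simp [sysB_empty]
  | insert y B hy ih =>
    rw [mem_insert, not_or] at hx
    rw [Finset.insert_comm, sysB_insert (by simp [hy, Ne.symm hx.1]), ih hx.2, sysB_insert hy]

/-- Two members of `F` differing in exactly one element. -/
def InclStep (F : Finset (Finset (Fin n))) (A B : Finset (Fin n)) : Prop :=
  A ∈ F ∧ B ∈ F ∧ (symmDiff A B).card = 1

/-- Any two members of `F` are joined by a path in the inclusion graph of `F`. -/
def InclLinked (F : Finset (Finset (Fin n))) : Prop :=
  ∀ A ∈ F, ∀ B ∈ F, Relation.ReflTransGen (InclStep F) A B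

theorem InclStep.symm {A B : Finset (Fin n)} (h : InclStep F A B) : InclStep F B A :=
  ⟨h.2.1, h.1, by rw [symmDiff_comm]; exact h.2.2⟩

theorem inclLinked_iff_preconnected : InclLinked F ↔ (inclGraph n F).Preconnected := by
  constructor
  · rintro h ⟨A, hA⟩ ⟨B, hB⟩
    have key : ∀ Z, Relation.ReflTransGen (InclStep F) A Z →
        ∃ hZ : Z ∈ F, (inclGraph n F).Reachable ⟨A, hA⟩ ⟨Z, hZ⟩ := by
      intro Z hZ
      induction hZ with
      | refl => exact ⟨hA, .refl _⟩
      | tail _ hs ih =>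
        obtain ⟨hZ, hr⟩ := ih
        refine ⟨hs.2.1, hr.trans (SimpleGraph.Adj.reachable ?_)⟩
        exact hs.2.2
    exact (key B (h A hA B hB)).2
  · intro h A hA B hB
    have := (SimpleGraph.reachable_iff_reflTransGen _ _).1 (h ⟨A, hA⟩ ⟨B, hB⟩)
    exact this.lift Subtype.val fun a b hab => ⟨a.2, b.2, hab⟩

theorem eq_insert_of_card_symmDiff {A B : Finset (Fin n)} {x : Fin n}
    (h : (symmDiff A B).card = 1) (hA : x ∉ A) (hB : x ∈ B) : B = insert x A := by
  obtain ⟨a, ha⟩ := card_eq_one.1 h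
  simp only [Finset.ext_iff, mem_symmDiff, mem_singleton] at ha
  ext y
  have h1 := ha x
  have h2 := ha y
  rw [mem_insert]
  grind

theorem card_symmDiff_insert {A : Finset (Fin n)} {x : Fin n} (hA : x ∉ A) :
    (symmDiff A (insert x A)).card = 1 := by
  rw [card_eq_one]
  refine ⟨x, ?_⟩
  ext y
  simp only [mem_symmDiff, mem_insert, mem_singleton]
  grind

theorem InclLinked.sysB_singleton_nonempty (h : InclLinked F) {x : Fin n}
    {A B : Finset (Fin n)} (hA : A ∈ F) (hB : B ∈ F) (hxA : x ∉ A) (hxB : x ∈ B) :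
    (sysB n F {x}).Nonempty := by
  by_contra hne
  have key : ∀ Z, Relation.ReflTransGen (InclStep F) A Z → x ∉ Z := by
    intro Z hZ
    induction hZ with
    | refl => exact hxA
    | @tail Y Z _ hs ih =>
      intro hxZ
      have := eq_insert_of_card_symmDiff hs.2.2 ih hxZ
      exact hne ⟨Y, mem_sysB_singleton.2 ⟨ih, hs.1, this ▸ hs.2.1⟩⟩
  exact key B (h A hA B hB) hxB

theorem InclStep.erase_mem_sysB {A B : Finset (Fin n)} {x : Fin n} (h : InclStep F A B)
    (hx : ¬(x ∈ A ↔ x ∈ B)) : A.erase x ∈ sysB n F {x} ∧ B.erase x ∈ sysB n F {x} := by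
  have aux : ∀ {A B : Finset (Fin n)}, InclStep F A B → x ∉ A → x ∈ B →
      A.erase x ∈ sysB n F {x} ∧ B.erase x ∈ sysB n F {x} := by
    intro A B h hA hB
    have hBA := eq_insert_of_card_symmDiff h.2.2 hA hB
    have : A ∈ sysB n F {x} := mem_sysB_singleton.2 ⟨hA, h.1, hBA ▸ h.2.1⟩
    rw [erase_eq_of_notMem hA, hBA, erase_insert hA]
    exact ⟨this, this⟩
  by_cases hA : x ∈ A
  · exact (aux h.symm (by tauto) hA).symm
  · exact aux h hA (by tauto)

/-- Restricting a linked system to the members containing (or to those avoiding) `x` keeps it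
linked, provided that `F({x})` is linked. -/
theorem InclLinked.filter {x : Fin n} (h : InclLinked F) (hx : InclLinked (sysB n F {x}))
    (H : Finset (Fin n)) : InclLinked (F.filter fun A => x ∈ A ↔ x ∈ H) := by
  set G := F.filter fun A => x ∈ A ↔ x ∈ H with hG
  have across : ∀ Z W, Z ∈ G → W ∈ G → Z.erase x ∈ sysB n F {x} →
      W.erase x ∈ sysB n F {x} → Relation.ReflTransGen (InclStep G) Z W := by
    intro Z W hZ hW hZx hWx
    set g : Finset (Fin n) → Finset (Fin n) := fun J => if x ∈ H then insert x J else J with hg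
    have hgE : ∀ Z ∈ G, g (Z.erase x) = Z := by
      intro Z hZ
      have := (mem_filter.1 hZ).2
      by_cases hxH : x ∈ H
      · simp [hg, hxH, insert_erase (this.2 hxH)]
      · simp [hg, hxH, erase_eq_of_notMem (mt this.1 hxH)]
    have hgm : ∀ J ∈ sysB n F {x}, g J ∈ G := by
      intro J hJ
      rw [mem_sysB_singleton] at hJ
      by_cases hxH : x ∈ H <;> simp [hg, hG, hxH, hJ]
    rw [← hgE Z hZ, ← hgE W hW]
    refine (hx _ hZx _ hWx).lift g fun I J hs => ⟨hgm I hs.1, hgm J hs.2.1, ?_⟩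
    have hI := (mem_sysB_singleton.1 hs.1).1
    have hJ := (mem_sysB_singleton.1 hs.2.1).1
    rw [← hs.2.2]
    congr 1
    by_cases hxH : x ∈ H
    · simp only [hg, hxH, if_true]
      ext y
      simp only [mem_symmDiff, mem_insert]
      grind
    · simp [hg, hxH]
  intro A hA B hB
  have key : ∀ Z, Relation.ReflTransGen (InclStep F) A Z →
      ((x ∈ Z ↔ x ∈ H) → Relation.ReflTransGen (InclStep G) A Z) ∧
      (¬(x ∈ Z ↔ x ∈ H) → ∀ W ∈ G, W.erase x ∈ sysB n F {x} →
        Relation.ReflTransGen (InclStep G) A W) := by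
    intro Z hZ
    induction hZ with
    | refl => exact ⟨fun _ => .refl, fun h => absurd (mem_filter.1 hA).2 h⟩
    | @tail Y Z _ hs ih =>
      by_cases hY : x ∈ Y ↔ x ∈ H
      · refine ⟨fun hZ => (ih.1 hY).tail
          ⟨mem_filter.2 ⟨hs.1, hY⟩, mem_filter.2 ⟨hs.2.1, hZ⟩, hs.2.2⟩, fun hZ W hW hWx => ?_⟩
        exact (ih.1 hY).trans (across Y W (mem_filter.2 ⟨hs.1, hY⟩) hW
          (hs.erase_mem_sysB (by tauto)).1 hWx)
      · exact ⟨fun hZ => ih.2 hY Z (mem_filter.2 ⟨hs.2.1, hZ⟩)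
          (hs.erase_mem_sysB (by tauto)).2, fun _ => ih.2 hY⟩
  exact (key B (h A (mem_filter.1 hA).1 B (mem_filter.1 hB).1)).1 (mem_filter.1 hB).2

theorem inclLinked_sysB_filter (h : ∀ B, InclLinked (sysB n F B)) (x : Fin n)
    (H B : Finset (Fin n)) : InclLinked (sysB n (F.filter fun A => x ∈ A ↔ x ∈ H) B) := by
  by_cases hx : x ∈ B
  · intro I hI
    rw [mem_sysB] at hI
    have hxI : x ∉ I := fun hI' => disjoint_left.1 hI.1 hI' hx
    have h0 := (mem_filter.1 (hI.2 ∅ (empty_subset _))).2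
    have h1 := (mem_filter.1 (hI.2 {x} (by simpa using hx))).2
    simp [hxI] at h0 h1
    exact absurd h1 h0
  · have : sysB n (F.filter fun A => x ∈ A ↔ x ∈ H) B =
        (sysB n F B).filter fun A => x ∈ A ↔ x ∈ H := by
      ext I
      simp only [mem_sysB, mem_filter, mem_union]
      refine ⟨fun ⟨h1, h2⟩ => ⟨⟨h1, fun K hK => (h2 K hK).1⟩, ?_⟩,
        fun ⟨⟨h1, h2⟩, h3⟩ => ⟨h1, fun K hK => ⟨h2 K hK, ?_⟩⟩⟩
      · simpa using (h2 ∅ (empty_subset _)).2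
      · have : x ∉ K := fun h => hx (hK h)
        simpa [this] using h3
    rw [this]
    exact (h B).filter (by rw [← sysB_insert hx]; exact h _) H

theorem inclLinked_sysB_filter_forall (h : ∀ B, InclLinked (sysB n F B))
    (T H B : Finset (Fin n)) :
    InclLinked (sysB n (F.filter fun A => ∀ y ∈ T, y ∈ A ↔ y ∈ H) B) := by
  induction T using Finset.induction_on generalizing B with
  | empty => simpa using h B
  | insert x T _ ih =>
    have := inclLinked_sysB_filter ih x H B
    rw [filter_filter] at this
    convert this using 4
    simp only [mem_insert, forall_eq_or_imp]
    exact and_comm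

theorem sysB_nonempty_of_shatters {S : Finset (Fin n)} (h : ∀ B, InclLinked (sysB n F B))
    (hS : F.Shatters S) : (sysB n F S).Nonempty := by
  induction S using Finset.induction_on generalizing F with
  | empty => simpa [sysB_empty] using hS
  | insert x T hx ih =>
    rw [sysB_insert' hx]
    refine ih (fun B => ?_) fun H hH => ?_
    · by_cases hxB : x ∈ B
      · intro I hI
        rw [mem_sysB] at hI
        have := (mem_sysB.1 (hI.2 {x} (by simpa using hxB))).1
        simp at this
      · rw [← sysB_insert' hxB]
        exact h _
    · have hxH : x ∉ H := fun h => hx (hH h)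
      obtain ⟨A, hA, hAH⟩ := hS (hH.trans (subset_insert x T))
      obtain ⟨B, hB, hBH⟩ := hS (insert_subset_insert x hH)
      simp only [Finset.ext_iff, mem_inter, mem_insert] at hAH hBH
      have hl := inclLinked_sysB_filter_forall h T H ∅
      rw [sysB_empty] at hl
      obtain ⟨J, hJ⟩ := hl.sysB_singleton_nonempty (x := x) (A := A) (B := B)
        (mem_filter.2 ⟨hA, fun y hy => by have := hAH y; tauto⟩)
        (mem_filter.2 ⟨hB, fun y hy => by
          have := hBH y
          have : y ≠ x := fun h => hx (h ▸ hy)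
          tauto⟩)
        (by have := hAH x; tauto) (by have := hBH x; tauto)
      simp only [mem_sysB_singleton, mem_filter] at hJ
      refine ⟨J, mem_sysB_singleton.2 ⟨hJ.1, hJ.2.1.1, hJ.2.2.1⟩, ?_⟩
      ext y
      have := hJ.2.1.2 y
      have := @hH y
      simp only [mem_inter]
      tauto

theorem shatters_compl_iff {S : Finset (Fin n)} :
    Fᶜ.Shatters Sᶜ ↔ ¬(sysB n F S).Nonempty := by
  simp only [Finset.Nonempty, mem_sysB, not_exists, not_and, not_forall]
  constructor
  · intro h I hI
    obtain ⟨A, hA, hAI⟩ := h (subset_compl_iff_disjoint_right.2 hI)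
    refine ⟨A ∩ S, inter_subset_right, ?_⟩
    have : I ∪ A ∩ S = A := by
      rw [← hAI, inter_comm Sᶜ, ← inter_union_distrib_left, union_comm, union_compl, inter_univ]
    rw [this]
    exact mem_compl.1 hA
  · intro h I hI
    have hd := subset_compl_iff_disjoint_right.1 hI
    obtain ⟨H, hH, hn⟩ := h I hd
    refine ⟨I ∪ H, mem_compl.2 hn, ?_⟩
    ext y
    have := @hH y
    have := @hI y
    simp only [mem_inter, mem_compl, mem_union] at *
    tauto

theorem card_filter_sysB_nonempty_le :
    (univ.filter fun S => (sysB n F S).Nonempty).card ≤ F.card := by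
  have h1 := card_le_card_shatterer Fᶜ
  have h2 : Fᶜ.shatterer.card = (univ.filter fun S => ¬(sysB n F S).Nonempty).card := by
    refine card_bij' (fun S _ => Sᶜ) (fun S _ => Sᶜ) ?_ ?_ ?_ ?_
    · intro S hS
      simpa only [mem_filter, mem_univ, true_and, ← shatters_compl_iff, compl_compl,
        mem_shatterer] using hS
    · intro S hS
      simpa only [mem_filter, mem_univ, true_and, ← shatters_compl_iff, mem_shatterer] using hS
    · simp
    · simp
  have h3 := card_filter_add_card_filter_not (s := (univ : Finset (Finset (Fin n))))
    fun S => (sysB n F S).Nonempty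
  have h4 := card_compl_add_card F
  rw [card_univ] at h3
  omega

theorem SExtremal.of_inclLinked (h : ∀ B, InclLinked (sysB n F B)) : SExtremal n F := by
  unfold SExtremal
  rw [Sh_eq_shatterer]
  refine le_antisymm (le_trans (card_le_card fun S hS => ?_) card_filter_sysB_nonempty_le)
    (card_le_card_shatterer F)
  exact mem_filter.2 ⟨mem_univ _, sysB_nonempty_of_shatters h (mem_shatterer.1 hS)⟩

theorem card_image_erase_add_card_sysB (x : Fin n) :
    (F.image fun A => A.erase x).card + (sysB n F {x}).card = F.card := by
  have h1 : F.image (fun A => A.erase x) = F.memberSubfamily x ∪ F.nonMemberSubfamily x := by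
    rw [memberSubfamily_union_nonMemberSubfamily]
  have h2 : sysB n F {x} = F.memberSubfamily x ∩ F.nonMemberSubfamily x := by
    ext I
    simp only [mem_sysB_singleton, mem_inter, mem_memberSubfamily, mem_nonMemberSubfamily]
    tauto
  rw [h1, h2, card_union_add_card_inter, card_memberSubfamily_add_card_nonMemberSubfamily]

theorem notMem_of_shatters {x : Fin n} {S : Finset (Fin n)} {G : Finset (Finset (Fin n))}
    (p : Prop) (hG : ∀ A ∈ G, (x ∈ A ↔ p)) (hS : G.Shatters S) : x ∉ S := by
  intro hx
  obtain ⟨A, hA, hAS⟩ := hS (singleton_subset_iff.2 hx)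
  obtain ⟨B, hB, hBS⟩ := hS (empty_subset S)
  have h1 : x ∈ A := (mem_inter.1 (hAS ▸ mem_singleton_self x)).2
  have h2 : x ∉ B := fun h => notMem_empty x (hBS ▸ mem_inter.2 ⟨hx, h⟩)
  exact h2 ((hG B hB).2 ((hG A hA).1 h1))

theorem shatters_sysB_singleton {x : Fin n} {S : Finset (Fin n)}
    (hS : (sysB n F {x}).Shatters S) :
    (F.filter (x ∉ ·)).Shatters S ∧ (F.filter (x ∈ ·)).Shatters S := by
  have hx := notMem_of_shatters False
    (fun A hA => iff_false_intro (mem_sysB_singleton.1 hA).1) hS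
  constructor <;> intro H hH <;> obtain ⟨A, hA, hAH⟩ := hS hH <;> rw [mem_sysB_singleton] at hA
  · exact ⟨A, mem_filter.2 ⟨hA.2.1, hA.1⟩, hAH⟩
  · exact ⟨insert x A, mem_filter.2 ⟨hA.2.2, mem_insert_self _ _⟩,
      by rw [inter_insert_of_notMem hx, hAH]⟩

theorem shatters_of_shatters_image_erase {x : Fin n} {S : Finset (Fin n)}
    (hS : (F.image fun A => A.erase x).Shatters S) : x ∉ S ∧ F.Shatters S := by
  have hx : x ∉ S := notMem_of_shatters False (by simp) hS
  refine ⟨hx, fun H hH => ?_⟩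
  obtain ⟨A, hA, hAH⟩ := hS hH
  obtain ⟨B, hB, rfl⟩ := mem_image.1 hA
  refine ⟨B, hB, ?_⟩
  rw [← hAH, inter_erase, erase_eq_of_notMem]
  exact fun h => hx (mem_inter.1 h).1

theorem shatters_insert {x : Fin n} {S : Finset (Fin n)}
    (h0 : (F.filter (x ∉ ·)).Shatters S) (h1 : (F.filter (x ∈ ·)).Shatters S) :
    F.Shatters (insert x S) := by
  intro H hH
  have hE : H.erase x ⊆ S := by rwa [← subset_insert_iff]
  by_cases hx : x ∈ H
  · obtain ⟨A, hA, hAH⟩ := h1 hE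
    refine ⟨A, (mem_filter.1 hA).1, ?_⟩
    rw [insert_inter_of_mem (mem_filter.1 hA).2, hAH, insert_erase hx]
  · obtain ⟨A, hA, hAH⟩ := h0 hE
    refine ⟨A, (mem_filter.1 hA).1, ?_⟩
    rw [insert_inter_of_notMem (mem_filter.1 hA).2, hAH, erase_eq_of_notMem hx]

theorem SExtremal.split (h : SExtremal n F) (x : Fin n) :
    SExtremal n (F.filter (x ∉ ·)) ∧ SExtremal n (F.filter (x ∈ ·)) ∧
      SExtremal n (sysB n F {x}) ∧
      (sysB n F {x}).card =
        ((F.filter (x ∉ ·)).shatterer ∩ (F.filter (x ∈ ·)).shatterer).card := by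
  simp only [SExtremal, Sh_eq_shatterer] at h ⊢
  set S0 := (F.filter (x ∉ ·)).shatterer with hS0
  set S1 := (F.filter (x ∈ ·)).shatterer with hS1
  have hx : ∀ S ∈ S0 ∪ S1, x ∉ S := by
    intro S hS
    rcases mem_union.1 hS with hS | hS
    · exact notMem_of_shatters False (by simp) (mem_shatterer.1 hS)
    · exact notMem_of_shatters True (by simp) (mem_shatterer.1 hS)
  have hI : Set.InjOn (insert x) (↑(S0 ∩ S1) : Set (Finset (Fin n))) := by
    intro S hS T hT hST
    have hS' := hx S (mem_union_left _ (mem_inter.1 hS).1)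
    have hT' := hx T (mem_union_left _ (mem_inter.1 hT).1)
    rw [← erase_insert hS', ← erase_insert hT', hST]
  have hsub : S0 ∪ S1 ⊆ F.shatterer.filter (x ∉ ·) := by
    intro S hS
    refine mem_filter.2 ⟨?_, hx S hS⟩
    rcases mem_union.1 hS with hS | hS
    · exact shatterer_mono (filter_subset _ _) hS
    · exact shatterer_mono (filter_subset _ _) hS
  have hsub' : (S0 ∩ S1).image (insert x) ⊆ F.shatterer.filter (¬ x ∉ ·) := by
    intro T hT
    obtain ⟨S, hS, rfl⟩ := mem_image.1 hT
    rw [mem_inter, mem_shatterer, mem_shatterer] at hS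
    exact mem_filter.2 ⟨mem_shatterer.2 (shatters_insert hS.1 hS.2), by simp⟩
  have c1 := card_le_card hsub
  have c2 := card_le_card hsub'
  rw [card_image_of_injOn hI] at c2
  have c3 := card_filter_add_card_filter_not (s := F.shatterer) (x ∉ ·)
  have c4 := card_union_add_card_inter S0 S1
  have c5 := card_filter_add_card_filter_not (s := F) (x ∉ ·)
  simp only [not_not] at c2 c3 c5
  have c6 := card_le_card_shatterer (F.filter (x ∉ ·))
  have c7 := card_le_card_shatterer (F.filter (x ∈ ·))
  rw [← hS0] at c6
  rw [← hS1] at c7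
  have c8 : (F.image fun A => A.erase x).shatterer ⊆ F.shatterer.filter (x ∉ ·) := by
    intro S hS
    have := shatters_of_shatters_image_erase (mem_shatterer.1 hS)
    exact mem_filter.2 ⟨mem_shatterer.2 this.2, this.1⟩
  have c9 := (card_le_card_shatterer _).trans (card_le_card c8)
  have c10 := card_image_erase_add_card_sysB (F := F) x
  have c11 : (sysB n F {x}).shatterer ⊆ S0 ∩ S1 := by
    intro S hS
    have := shatters_sysB_singleton (mem_shatterer.1 hS)
    exact mem_inter.2 ⟨mem_shatterer.2 this.1, mem_shatterer.2 this.2⟩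
  have c12 := card_le_card c11
  have c13 := card_le_card_shatterer (sysB n F {x})
  refine ⟨?_, ?_, ?_, ?_⟩ <;> omega

theorem SExtremal.sysB (h : SExtremal n F) (B : Finset (Fin n)) : SExtremal n (sysB n F B) := by
  induction B using Finset.induction_on with
  | empty => rwa [sysB_empty]
  | insert x B hx ih =>
    rw [sysB_insert hx]
    exact (ih.split x).2.2.1

theorem SExtremal.inclLinked (h : SExtremal n F) : InclLinked F := by
  induction hk : F.card using Nat.strong_induction_on generalizing F with
  | _ k ih =>
  subst hk
  intro A hA B hB
  by_cases hAB : A = B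
  · rw [hAB]
  obtain ⟨x, hx⟩ : ∃ x, ¬(x ∈ A ↔ x ∈ B) := by
    by_contra! hc
    exact hAB (Finset.ext hc)
  obtain ⟨h0, h1, -, hc⟩ := h.split x
  have ne0 : (F.filter (x ∉ ·)).Nonempty := by
    by_cases hxA : x ∈ A
    · exact ⟨B, mem_filter.2 ⟨hB, by tauto⟩⟩
    · exact ⟨A, mem_filter.2 ⟨hA, hxA⟩⟩
  have ne1 : (F.filter (x ∈ ·)).Nonempty := by
    by_cases hxA : x ∈ A
    · exact ⟨A, mem_filter.2 ⟨hA, hxA⟩⟩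
    · exact ⟨B, mem_filter.2 ⟨hB, by tauto⟩⟩
  have hpos : 0 < (_root_.sysB n F {x}).card := by
    rw [hc, card_pos]
    exact ⟨∅, by simp only [mem_inter, mem_shatterer, shatters_empty]; exact ⟨ne0, ne1⟩⟩
  obtain ⟨J, hJ⟩ := card_pos.1 hpos
  rw [mem_sysB_singleton] at hJ
  have hcard := card_filter_add_card_filter_not (s := F) (x ∉ ·)
  simp only [not_not] at hcard
  have p0 := card_pos.2 ne0
  have p1 := card_pos.2 ne1
  have l0 := ih _ (by omega) h0 rfl
  have l1 := ih _ (by omega) h1 rfl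
  have mono : ∀ {G : Finset (Finset (Fin n))} {Z W : Finset (Fin n)}, G ⊆ F →
      Relation.ReflTransGen (InclStep G) Z W → Relation.ReflTransGen (InclStep F) Z W :=
    fun hG hr => hr.lift id fun _ _ hs => ⟨hG hs.1, hG hs.2.1, hs.2.2⟩
  have reach : ∀ Z ∈ F, Relation.ReflTransGen (InclStep F) J Z := by
    intro Z hZ
    by_cases hxZ : x ∈ Z
    · exact .head ⟨hJ.2.1, hJ.2.2, card_symmDiff_insert hJ.1⟩
        (mono (filter_subset _ _) (l1 _ (mem_filter.2 ⟨hJ.2.2, mem_insert_self _ _⟩) Z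
          (mem_filter.2 ⟨hZ, hxZ⟩)))
    · exact mono (filter_subset _ _) (l0 J (mem_filter.2 ⟨hJ.2.1, hJ.1⟩) Z
        (mem_filter.2 ⟨hZ, hxZ⟩))
  have : Std.Symm (InclStep F) := ⟨fun _ _ hs => hs.symm⟩
  exact (Std.Symm.symm _ _ (reach A hA)).trans (reach B hB)

end

/-- Bollobás–Radcliffe: A nonempty set system `F` is
s-extremal iff the inclusion graph of `F(B)` is connected for every `B` with
`F(B)` nonempty. -/
theorem stmt15 (n : ℕ) (F : Finset (Finset (Fin n))) (hF : F.Nonempty) :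
    SExtremal n F ↔
      ∀ B : Finset (Fin n), (sysB n F B).Nonempty →
        (inclGraph n (sysB n F B)).Connected := by
  constructor
  · intro h B hB
    have : Nonempty {A // A ∈ sysB n F B} := hB.to_subtype
    exact ⟨inclLinked_iff_preconnected.1 (h.sysB B).inclLinked⟩
  · intro h
    refine SExtremal.of_inclLinked fun B => ?_
    by_cases hB : (sysB n F B).Nonempty
    · exact inclLinked_iff_preconnected.2 (h B hB).preconnected
    · intro A hA
      exact absurd ⟨A, hA⟩ hB
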